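/- Let Γ be a (3,10,41)-graph with diam(Γ) = 2 and let v be a vertex of Γ with d(v) = 6. Let H_{21}(v) = {u ∈ V(Γ_v) : |N(u) ∩ N(v)| = 1}. Then 20 ≤ |H_{21}(v)| ≤ 24. -/

import Mathlib

/-- `H2 Γ v i` = the set of vertices u of Γ_v (i.e. outside the closed neighbourhood of v)
having exactly i common neighbours with v. -/
def H2 {n : ℕ} (Γ : SimpleGraph (Fin n)) (v : Fin n) (i : ℕ) : Set (Fin n) :=
  {u | u ∉ (Γ.neighborSet v ∪ {v}) ∧ (Γ.neighborSet u ∩ Γ.neighborSet v).ncard = i}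

theorem aux_indep (Γ : SimpleGraph (Fin 41)) (h10 : Γᶜ.CliqueFree 10) (s : Finset (Fin 41))
    (hs : ∀ a ∈ s, ∀ b ∈ s, ¬ Γ.Adj a b) : s.card ≤ 9 := by
  by_contra hc
  obtain ⟨t, hts, ht⟩ := Finset.exists_subset_card_eq (show 10 ≤ s.card by omega)
  refine h10 t ⟨?_, ht⟩
  intro a ha b hb hab
  rw [SimpleGraph.compl_adj]
  exact ⟨hab, hs a (hts ha) b (hts hb)⟩

theorem aux_tri (Γ : SimpleGraph (Fin 41)) (h3 : Γ.CliqueFree 3) (a b c : Fin 41)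
    (h1 : Γ.Adj a b) (h2 : Γ.Adj a c) : ¬ Γ.Adj b c := fun h =>
  h3 {a, b, c} (SimpleGraph.is3Clique_triple_iff.2 ⟨h1, h2, h⟩)

theorem aux_common (Γ : SimpleGraph (Fin 41)) (hdiam : Γ.diam = 2) (u v : Fin 41) (hne : u ≠ v)
    (hn : ¬ Γ.Adj u v) : ∃ w, Γ.Adj u w ∧ Γ.Adj w v := by
  have htop : Γ.ediam ≠ ⊤ := by
    intro h
    simp [SimpleGraph.diam, h] at hdiam
  have hd : Γ.dist u v ≤ 2 := hdiam ▸ SimpleGraph.dist_le_diam htop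
  have hc : Γ.Connected := SimpleGraph.connected_of_ediam_ne_top htop
  obtain ⟨p, hp⟩ := hc.exists_walk_length_eq_dist u v
  rw [← hp] at hd
  cases p with
  | nil => exact absurd rfl hne
  | cons h q =>
    cases q with
    | nil => exact absurd h hn
    | cons h' r =>
      cases r with
      | nil => exact ⟨_, h, h'⟩
      | cons _ _ => simp at hd

theorem stmt_10 (Γ : SimpleGraph (Fin 41)) [DecidableRel Γ.Adj]
    (h3 : Γ.CliqueFree 3) (h10 : Γᶜ.CliqueFree 10)
    (hdiam : Γ.diam = 2) (v : Fin 41) (hv : Γ.degree v = 6) :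
    20 ≤ (H2 Γ v 1).ncard ∧ (H2 Γ v 1).ncard ≤ 24 := by
  classical
  have hN : (Γ.neighborFinset v).card = 6 := by simpa using hv
  generalize hNd : Γ.neighborFinset v = N at hN
  have mN : ∀ w, w ∈ N ↔ Γ.Adj v w := by intro w; simp [← hNd]
  set W : Finset (Fin 41) := Finset.univ \ insert v N with hW
  have hvN : v ∉ N := by simp [mN]
  have hWc : W.card = 34 := by
    rw [hW, Finset.card_sdiff_of_subset (Finset.subset_univ _), Finset.card_insert_of_notMem hvN, hN]
    simp
  have mW : ∀ u, u ∈ W ↔ u ≠ v ∧ ¬ Γ.Adj v u := by intro u; simp [hW, mN]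
  set H : Finset (Fin 41) := W.filter (fun u => (N.filter (fun w => Γ.Adj u w)).card = 1) with hH
  have hHe : H2 Γ v 1 = (H : Set (Fin 41)) := by
    ext u
    have : Γ.neighborSet u ∩ Γ.neighborSet v = ((N.filter (fun w => Γ.Adj u w) : Finset (Fin 41)) : Set (Fin 41)) := by
      ext w; simp [mN, and_comm]
    simp only [H2, Set.mem_ofPred_eq, this, Set.ncard_coe_finset, hH, Finset.mem_coe, Finset.mem_filter, mW]
    simp
  rw [hHe, Set.ncard_coe_finset]
  have hpos : ∀ u ∈ W, 1 ≤ (N.filter (fun w => Γ.Adj u w)).card := by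
    intro u hu
    rw [mW] at hu
    obtain ⟨w, h1, h2⟩ := aux_common Γ hdiam u v hu.1 (fun h => hu.2 h.symm)
    exact Finset.card_pos.2 ⟨w, by simp [mN, h1, h2.symm]⟩
  constructor
  · have hdc : ∑ u ∈ W, (N.filter (fun w => Γ.Adj u w)).card
        = ∑ w ∈ N, (W.filter (fun u => Γ.Adj u w)).card :=
      Finset.sum_card_bipartiteAbove_eq_sum_card_bipartiteBelow (fun u w => Γ.Adj u w)
    have hle : ∑ w ∈ N, (W.filter (fun u => Γ.Adj u w)).card ≤ N.card * 8 := by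
      rw [← smul_eq_mul]
      apply Finset.sum_le_card_nsmul
      intro w hw
      rw [mN] at hw
      have hnot : v ∉ W.filter (fun u => Γ.Adj u w) := by simp [mW]
      have := aux_indep Γ h10 (insert v (W.filter (fun u => Γ.Adj u w))) (by
        have key : ∀ a ∈ insert v (W.filter (fun u => Γ.Adj u w)), Γ.Adj w a := by
          intro a ha
          rw [Finset.mem_insert, Finset.mem_filter] at ha
          rcases ha with rfl | ha
          · exact hw.symm
          · exact ha.2.symm
        intro a ha b hb
        exact aux_tri Γ h3 w a b (key a ha) (key b hb))
      rw [Finset.card_insert_of_notMem hnot] at this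
      omega
    have hge : ∑ u ∈ W, 2 ≤ ∑ u ∈ W, ((N.filter (fun w => Γ.Adj u w)).card
        + if (N.filter (fun w => Γ.Adj u w)).card = 1 then 1 else 0) := by
      apply Finset.sum_le_sum
      intro u hu
      have := hpos u hu
      split_ifs <;> omega
    rw [Finset.sum_add_distrib, ← Finset.card_filter, ← hH] at hge
    simp only [Finset.sum_const, smul_eq_mul] at hge
    omega
  · have hsub : H ⊆ N.biUnion (fun w => H.filter (fun u => Γ.Adj u w)) := by
      intro u hu
      have hu' := hpos u (Finset.mem_filter.1 hu).1
      obtain ⟨w, hw⟩ := Finset.card_pos.1 hu'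
      rw [Finset.mem_filter] at hw
      exact Finset.mem_biUnion.2 ⟨w, hw.1, Finset.mem_filter.2 ⟨hu, hw.2⟩⟩
    have hb : (N.biUnion (fun w => H.filter (fun u => Γ.Adj u w))).card ≤ N.card * 4 := by
      apply Finset.card_biUnion_le_card_mul
      intro w hw
      have hPN : ∀ a ∈ H.filter (fun u => Γ.Adj u w), ∀ b ∈ N.erase w, ¬ Γ.Adj a b := by
        intro a ha b hb hab
        rw [Finset.mem_filter, hH, Finset.mem_filter] at ha
        rw [Finset.mem_erase] at hb
        exact hb.1 (Finset.card_le_one.1 ha.1.2.le b (Finset.mem_filter.2 ⟨hb.2, hab⟩) w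
          (Finset.mem_filter.2 ⟨hw, ha.2⟩))
      have hdis : Disjoint (H.filter (fun u => Γ.Adj u w)) (N.erase w) := by
        rw [Finset.disjoint_left]
        intro a ha hb
        rw [Finset.mem_filter, hH, Finset.mem_filter, mW] at ha
        exact ha.1.1.2 ((mN a).1 (Finset.mem_of_mem_erase hb))
      have := aux_indep Γ h10 (H.filter (fun u => Γ.Adj u w) ∪ N.erase w) (by
        intro a ha b hb
        rw [Finset.mem_union] at ha hb
        rcases ha with ha | ha <;> rcases hb with hb | hb
        · exact aux_tri Γ h3 w a b (Finset.mem_filter.1 ha).2.symm (Finset.mem_filter.1 hb).2.symm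
        · exact hPN a ha b hb
        · exact fun h => hPN b hb a ha h.symm
        · exact aux_tri Γ h3 v a b ((mN a).1 (Finset.mem_of_mem_erase ha))
            ((mN b).1 (Finset.mem_of_mem_erase hb)))
      rw [Finset.card_union_of_disjoint hdis, Finset.card_erase_of_mem hw, hN] at this
      omega
    have := Finset.card_le_card hsub
    omega
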